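/- arXiv:2007.01624 — 2 statements merged into one kernel-verified Lean document; each statement's English description precedes it below -/
import Mathlib

section
/- Let β ≥ 0 and μ = μ₊ − μ₋ ∈ 𝔐_β. Then the following are equivalent: (i) for every λ ∈ ℝ, every linear subspace L of D(a_μ) satisfying a_μ(f, f) < λ‖f‖² for every f ∈ L with f ≠ 0 is finite-dimensional; (ii) q*_{μ₊}(x) → ∞ as |x| → ∞. (By Glazman's lemma, (i) is equivalent to the spectrum of the operator H_μ associated with a_μ being purely discrete.) -/
open MeasureTheory Set Filter ENNReal

/-- `d_μ(x) = sup {d ≥ 0 : d·μ([x − d/2, x + d/2]) ≤ 1}` (a real number; by Lean's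
convention `sSup` of a set unbounded above is `0`, which corresponds to `d_μ(x) = ∞`). -/
noncomputable def dFun (μ : Measure ℝ) (x : ℝ) : ℝ :=
  sSup {d : ℝ | 0 ≤ d ∧ ENNReal.ofReal d * μ (Icc (x - d / 2) (x + d / 2)) ≤ 1}

/-- Otelbaev's function `q*_μ(x) = 1/d_μ(x)²` (equal to `0` when `d_μ(x) = ∞`,
by the convention `1/0 = 0`). -/
noncomputable def qstar (μ : Measure ℝ) (x : ℝ) : ℝ := 1 / (dFun μ x) ^ 2

/-- `∫ |f|² dν`, as a value in `[0, ∞]`. -/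
noncomputable def sqInt (ν : Measure ℝ) (f : ℝ → ℂ) : ℝ≥0∞ :=
  ∫⁻ x, (‖f x‖₊ : ℝ≥0∞) ^ 2 ∂ν

/-- `f` belongs to the form domain `D(a_μ)` with a.e. derivative `g`:
`f` is locally absolutely continuous (an indefinite integral of the locally integrable
function `g`), `f ∈ L²(ℝ)`, `g = f′ ∈ L²(ℝ)` and `∫ |f|² dμ₊ < ∞`. -/
structure MemDom (μp : Measure ℝ) (f g : ℝ → ℂ) : Prop where
  locInt : LocallyIntegrable g volume
  fund : ∀ a b : ℝ, f b - f a = ∫ x in a..b, g x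
  f_L2 : sqInt volume f < ⊤
  g_L2 : sqInt volume g < ⊤
  f_mu : sqInt μp f < ⊤

/-- The quadratic form `a_μ(f, f) = ∫ |f′|² dx + ∫ |f|² dμ₊ − ∫ |f|² dμ₋`,
where `g` is the a.e. derivative of `f`. -/
noncomputable def formQ (μp μm : Measure ℝ) (f g : ℝ → ℂ) : ℝ :=
  (sqInt volume g).toReal + (sqInt μp f).toReal - (sqInt μm f).toReal

/-- `L` is a linear subspace of `D(a_μ)` on which `a_μ(f, f) < λ·‖f‖²` for every
nonzero `f ∈ L` (the class of subspaces appearing in Glazman's lemma). -/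
def GoodSubspace (μp μm : Measure ℝ) (lam : ℝ) (L : Submodule ℂ (ℝ → ℂ)) : Prop :=
  (∀ f ∈ L, ∃ g, MemDom μp f g) ∧
    ∀ f ∈ L, f ≠ 0 → ∀ g : ℝ → ℂ, MemDom μp f g →
      formQ μp μm f g < lam * (sqInt volume f).toReal

theorem ENNReal.add_sq_le_two_mul (a b : ℝ≥0∞) : (a + b) ^ 2 ≤ 2 * a ^ 2 + 2 * b ^ 2 := by
  rcases eq_or_ne a ⊤ with rfl | ha
  · simp
  rcases eq_or_ne b ⊤ with rfl | hb
  · simp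
  lift a to NNReal using ha
  lift b to NNReal using hb
  norm_cast
  rw [← NNReal.coe_le_coe]
  push_cast
  nlinarith [sq_nonneg ((a : ℝ) - b)]

theorem sq_setLIntegral_le {α : Type*} [MeasurableSpace α] {ν : Measure α} (s : Set α)
    {h : α → ℝ≥0∞} (hh : AEMeasurable h (ν.restrict s)) :
    (∫⁻ x in s, h x ∂ν) ^ 2 ≤ ν s * ∫⁻ x in s, h x ^ 2 ∂ν := by
  have H := ENNReal.lintegral_mul_le_Lp_mul_Lq (ν.restrict s) Real.HolderConjugate.two_two
    (aemeasurable_const (b := (1 : ℝ≥0∞))) hh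
  simp only [Pi.mul_apply, one_mul, lintegral_const, Measure.restrict_apply_univ,
    ENNReal.rpow_two, one_pow] at H
  have hsq : ∀ a : ℝ≥0∞, (a ^ (1 / 2 : ℝ)) ^ 2 = a := fun a => by
    rw [← ENNReal.rpow_two, ← ENNReal.rpow_mul]; norm_num
  calc _ ≤ _ := pow_le_pow_left' H 2
    _ = _ := by rw [mul_pow, hsq, hsq]

theorem lintegral_eq_tsum_Ioc {t : ℝ} (ht : 0 < t) (ν : Measure ℝ) (h : ℝ → ℝ≥0∞) :
    ∫⁻ x, h x ∂ν = ∑' k : ℤ, ∫⁻ x in Ioc (k • t) ((k + 1) • t), h x ∂ν := by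
  rw [← lintegral_iUnion (fun _ => measurableSet_Ioc) (pairwise_disjoint_Ioc_zsmul t),
    iUnion_Ioc_zsmul ht, setLIntegral_univ]

namespace MemDom

variable {μp : Measure ℝ} {f g : ℝ → ℂ}

theorem continuous (H : MemDom μp f g) : Continuous f := by
  have h : f = fun b => f 0 + ∫ x in (0 : ℝ)..b, g x := by
    funext b
    rw [← H.fund 0 b]; ring
  rw [h]
  exact continuous_const.add
    (intervalIntegral.continuous_primitive (fun a b =>
      (H.locInt.integrableOn_isCompact isCompact_uIcc).intervalIntegrable) 0)

theorem ae_hasDerivAt (H : MemDom μp f g) : ∀ᵐ x, HasDerivAt f (g x) x := by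
  filter_upwards [LocallyIntegrable.ae_hasDerivAt_integral H.locInt] with x hx
  have h : f = fun b => f 0 + ∫ x in (0 : ℝ)..b, g x := by
    funext b
    rw [← H.fund 0 b]; ring
  rw [h]
  exact (hx 0).const_add _

theorem sqInt_deriv_congr {g' : ℝ → ℂ} (H : MemDom μp f g) (H' : MemDom μp f g') :
    sqInt volume g = sqInt volume g' := by
  refine lintegral_congr_ae ?_
  filter_upwards [H.ae_hasDerivAt, H'.ae_hasDerivAt] with x h h'
  simp only [h.unique h']

theorem aemeasurable (H : MemDom μp f g) : AEMeasurable g :=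
  H.locInt.aestronglyMeasurable.aemeasurable

theorem enorm_sub_sq_le (H : MemDom μp f g) {a b x y : ℝ} (hx : x ∈ Icc a b) (hy : y ∈ Icc a b) :
    ‖f x - f y‖ₑ ^ 2 ≤ ENNReal.ofReal (b - a) * ∫⁻ z in Ioc a b, ‖g z‖ₑ ^ 2 := by
  have h1 : ‖f x - f y‖ₑ ≤ ∫⁻ z in Ioc a b, ‖g z‖ₑ := by
    rw [H.fund y x, ← ofReal_norm, intervalIntegral.norm_intervalIntegral_eq, ofReal_norm]
    refine (enorm_integral_le_lintegral_enorm _).trans (lintegral_mono_set ?_)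
    exact Ioc_subset_Ioc (le_inf hy.1 hx.1) (sup_le hy.2 hx.2)
  calc _ ≤ _ := pow_le_pow_left' h1 2
    _ ≤ _ := sq_setLIntegral_le _ H.aemeasurable.enorm.restrict
    _ = _ := by rw [Real.volume_Ioc]

theorem enorm_sq_le (H : MemDom μp f g) {a b x y : ℝ} (hx : x ∈ Icc a b) (hy : y ∈ Icc a b) :
    ‖f x‖ₑ ^ 2 ≤ 2 * ‖f y‖ₑ ^ 2 + 2 * (ENNReal.ofReal (b - a) * ∫⁻ z in Ioc a b, ‖g z‖ₑ ^ 2) := by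
  calc ‖f x‖ₑ ^ 2 = ‖f y + (f x - f y)‖ₑ ^ 2 := by rw [add_sub_cancel]
    _ ≤ (‖f y‖ₑ + ‖f x - f y‖ₑ) ^ 2 := pow_le_pow_left' (enorm_add_le _ _) 2
    _ ≤ 2 * ‖f y‖ₑ ^ 2 + 2 * ‖f x - f y‖ₑ ^ 2 := ENNReal.add_sq_le_two_mul _ _
    _ ≤ _ := by gcongr; exact H.enorm_sub_sq_le hx hy

theorem setLIntegral_sq_le (H : MemDom μp f g) (ρ : Measure ℝ) {a b y : ℝ} (hy : y ∈ Icc a b) :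
    ∫⁻ x in Ioc a b, ‖f x‖ₑ ^ 2 ∂ρ ≤ ρ (Ioc a b) *
      (2 * ‖f y‖ₑ ^ 2 + 2 * (ENNReal.ofReal (b - a) * ∫⁻ z in Ioc a b, ‖g z‖ₑ ^ 2)) := by
  rw [mul_comm, ← setLIntegral_const]
  exact setLIntegral_mono' measurableSet_Ioc fun x hx => H.enorm_sq_le (Ioc_subset_Icc_self hx) hy

theorem measure_mul_setLIntegral_sq_le (H : MemDom μp f g) (ρ ν : Measure ℝ) (a b : ℝ) :
    ν (Ioc a b) * ∫⁻ x in Ioc a b, ‖f x‖ₑ ^ 2 ∂ρ ≤ ρ (Ioc a b) *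
      (2 * (∫⁻ y in Ioc a b, ‖f y‖ₑ ^ 2 ∂ν) + 2 * (ENNReal.ofReal (b - a) *
        ∫⁻ z in Ioc a b, ‖g z‖ₑ ^ 2) * ν (Ioc a b)) := by
  have hm : Measurable fun y => ‖f y‖ₑ ^ 2 := H.continuous.measurable.enorm.pow_const 2
  rw [mul_comm, ← setLIntegral_const]
  refine (setLIntegral_mono' measurableSet_Ioc fun y hy =>
    H.setLIntegral_sq_le ρ (Ioc_subset_Icc_self hy)).trans_eq ?_
  rw [lintegral_const_mul _ ((hm.const_mul 2).add_const _), lintegral_add_right _ measurable_const,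
    lintegral_const_mul _ hm, setLIntegral_const]

theorem ofReal_mul_sqInt_le (H : MemDom μp f g) {β : ℝ} {μm : Measure ℝ}
    (hμm : ∀ x : ℝ, μm (Icc x (x + 1)) ≤ ENNReal.ofReal β) {t : ℝ} (ht : 0 < t) (ht1 : t ≤ 1) :
    ENNReal.ofReal t * sqInt μm f ≤ ENNReal.ofReal β *
      (2 * sqInt volume f + 2 * (ENNReal.ofReal t * sqInt volume g) * ENNReal.ofReal t) := by
  unfold sqInt
  rw [lintegral_eq_tsum_Ioc ht μm, lintegral_eq_tsum_Ioc ht volume fun x => (‖f x‖₊ : ℝ≥0∞) ^ 2,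
    lintegral_eq_tsum_Ioc ht volume fun x => (‖g x‖₊ : ℝ≥0∞) ^ 2]
  simp only [← ENNReal.tsum_mul_left, ← ENNReal.tsum_mul_right, ← ENNReal.tsum_add]
  refine ENNReal.tsum_le_tsum fun k => ?_
  have hk : (k + 1) • t - k • t = t := by rw [add_smul, one_smul, add_sub_cancel_left]
  have h := H.measure_mul_setLIntegral_sq_le μm volume (k • t) ((k + 1) • t)
  rw [Real.volume_Ioc, hk] at h
  refine h.trans ?_
  gcongr
  · refine (measure_mono ?_).trans (hμm (k • t))
    exact Ioc_subset_Icc_self.trans (Icc_subset_Icc_right (by linarith))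
  · exact le_rfl
  · exact le_rfl

theorem toReal_sqInt_le (H : MemDom μp f g) {β : ℝ} (hβ : 0 ≤ β) {μm : Measure ℝ}
    (hμm : ∀ x : ℝ, μm (Icc x (x + 1)) ≤ ENNReal.ofReal β) :
    (sqInt μm f).toReal ≤ 2 * β * (4 * β + 1) * (sqInt volume f).toReal
      + 1 / 2 * (sqInt volume g).toReal := by
  set t : ℝ := (4 * β + 1)⁻¹ with ht_def
  have ht : 0 < t := by positivity
  have ht1 : t ≤ 1 := inv_le_one_of_one_le₀ (by linarith)
  have hb : (4 * β + 1) * t = 1 := mul_inv_cancel₀ (by positivity)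
  have h := ENNReal.toReal_mono (by finiteness [H.f_L2.ne, H.g_L2.ne])
    (H.ofReal_mul_sqInt_le hμm ht ht1)
  rw [ENNReal.toReal_mul, ENNReal.toReal_mul, ENNReal.toReal_add (by finiteness [H.f_L2.ne])
    (by finiteness [H.g_L2.ne])] at h
  simp only [ENNReal.toReal_mul, ENNReal.toReal_ofReal ht.le, ENNReal.toReal_ofReal hβ,
    ENNReal.toReal_ofNat] at h
  have hg : 0 ≤ (sqInt volume g).toReal := ENNReal.toReal_nonneg
  calc _ = (4 * β + 1) * (t * (sqInt μm f).toReal) := by rw [← mul_assoc, hb, one_mul]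
    _ ≤ _ := mul_le_mul_of_nonneg_left h (by positivity)
    _ = 2 * β * (4 * β + 1) * (sqInt volume f).toReal
        + ((4 * β + 1) * t) * (2 * (β * t)) * (sqInt volume g).toReal := by ring
    _ ≤ _ := by
      rw [hb]
      gcongr
      nlinarith

theorem sqInt_le_of_zero_or_one_le (H : MemDom μp f g) [IsFiniteMeasureOnCompacts μp] {t : ℝ}
    (ht : 0 < t)
    (hz : ∀ k : ℤ, f (k • t) = 0 ∨ 1 ≤ ENNReal.ofReal t * μp (Ioc (k • t) ((k + 1) • t))) :
    sqInt volume f ≤ 2 * ENNReal.ofReal t ^ 2 * (sqInt μp f + sqInt volume g) := by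
  unfold sqInt
  rw [lintegral_eq_tsum_Ioc ht μp, lintegral_eq_tsum_Ioc ht volume fun x => (‖f x‖₊ : ℝ≥0∞) ^ 2,
    lintegral_eq_tsum_Ioc ht volume fun x => (‖g x‖₊ : ℝ≥0∞) ^ 2]
  simp only [← ENNReal.tsum_mul_left, ← ENNReal.tsum_add]
  refine ENNReal.tsum_le_tsum fun k => ?_
  have hk : (k + 1) • t - k • t = t := by rw [add_smul, one_smul, add_sub_cancel_left]
  have hle : k • t ≤ (k + 1) • t := by linarith
  rcases hz k with h0 | h1
  · have h := H.setLIntegral_sq_le volume (left_mem_Icc.2 hle)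
    rw [Real.volume_Ioc, hk, h0, enorm_zero] at h
    refine h.trans ?_
    rw [mul_add (2 * ENNReal.ofReal t ^ 2)]
    refine le_add_left (le_of_eq ?_)
    simp only [enorm]
    ring
  · have h := H.measure_mul_setLIntegral_sq_le volume μp (k • t) ((k + 1) • t)
    rw [Real.volume_Ioc, hk] at h
    set m := μp (Ioc (k • t) ((k + 1) • t)) with hm
    have hm_top : m ≠ ⊤ := ((measure_mono Ioc_subset_Icc_self).trans_lt
      isCompact_Icc.measure_lt_top).ne
    have hm0 : m ≠ 0 := by
      intro h0
      simp [h0] at h1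
    refine (ENNReal.mul_le_mul_iff_right hm0 hm_top).1 (h.trans ?_)
    simp only [enorm]
    generalize (∫⁻ x in Ioc (k • t) ((k + 1) • t), (‖f x‖₊ : ℝ≥0∞) ^ 2 ∂μp) = P
    generalize (∫⁻ x in Ioc (k • t) ((k + 1) • t), (‖g x‖₊ : ℝ≥0∞) ^ 2) = G
    calc ENNReal.ofReal t * (2 * P + 2 * (ENNReal.ofReal t * G) * m)
        = 1 * (2 * ENNReal.ofReal t * P) + 2 * ENNReal.ofReal t ^ 2 * m * G := by ring
      _ ≤ (ENNReal.ofReal t * m) * (2 * ENNReal.ofReal t * P)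
          + 2 * ENNReal.ofReal t ^ 2 * m * G := by gcongr
      _ = _ := by ring

end MemDom

theorem tendsto_qstar_iff (μ : Measure ℝ) [IsFiniteMeasureOnCompacts μ] (hμ : μ univ ≠ 0) :
    Tendsto (qstar μ) (cocompact ℝ) atTop ↔ ∀ ε : ℝ, 0 < ε → ∀ᶠ x in cocompact ℝ,
      1 < ENNReal.ofReal ε * μ (Icc (x - ε / 2) (x + ε / 2)) := by
  constructor
  · intro h ε hε
    filter_upwards [h.eventually_gt_atTop (1 / ε ^ 2)] with x hx
    by_contra! hle
    have hbdd : BddAbove {d : ℝ | 0 ≤ d ∧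
        ENNReal.ofReal d * μ (Icc (x - d / 2) (x + d / 2)) ≤ 1} := by
      obtain ⟨n, hn⟩ : ∃ n : ℕ, μ (Icc (x - n) (x + n)) ≠ 0 := by
        by_contra! h0
        refine hμ (measure_mono_null (fun y _ => ?_) (measure_iUnion_null h0))
        obtain ⟨n, hn⟩ := exists_nat_ge |y - x|
        have := abs_le.1 hn
        exact mem_iUnion.2 ⟨n, by constructor <;> linarith⟩
      obtain ⟨m, hm⟩ := ENNReal.exists_nat_mul_gt hn ENNReal.one_ne_top
      refine ⟨max (2 * n) m, fun d ⟨hd, hd1⟩ => ?_⟩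
      by_contra! hlt
      obtain ⟨hl, hr⟩ := max_lt_iff.1 hlt
      refine (hm.trans_le ?_).not_ge hd1
      gcongr
      · rw [← ENNReal.ofReal_natCast]
        exact ENNReal.ofReal_le_ofReal hr.le
      · linarith
      · linarith
    have hd : ε ≤ dFun μ x := le_csSup hbdd ⟨hε.le, hle⟩
    refine hx.not_ge ?_
    unfold qstar
    gcongr
  · intro h
    refine tendsto_atTop.2 fun C => ?_
    have hε : 0 < 1 / (|C| + 1) := by positivity
    filter_upwards [h _ hε] with x hx
    set ε := 1 / (|C| + 1) with hε_def
    have hub : ∀ d ∈ {d : ℝ | 0 ≤ d ∧ ENNReal.ofReal d * μ (Icc (x - d / 2) (x + d / 2)) ≤ 1},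
        d ≤ ε := by
      rintro d ⟨hd, hd1⟩
      by_contra! hlt
      refine (hx.trans_le ?_).not_ge hd1
      gcongr
    have hle : dFun μ x ≤ ε := csSup_le ⟨0, by simp⟩ hub
    have hpos : 0 < dFun μ x := by
      set m := (μ (Icc (x - 1) (x + 1))).toReal with hm
      have hm0 : 0 ≤ m := ENNReal.toReal_nonneg
      have hd1 : 1 / (m + 1) ≤ 1 := (div_le_one (by positivity)).2 (by linarith)
      refine lt_of_lt_of_le (by positivity : 0 < 1 / (m + 1))
        (le_csSup ⟨ε, hub⟩ ⟨by positivity, ?_⟩)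
      calc _ ≤ ENNReal.ofReal (1 / (m + 1)) * μ (Icc (x - 1) (x + 1)) := by
            gcongr <;> linarith
        _ = ENNReal.ofReal (1 / (m + 1) * m) := by
            rw [ENNReal.ofReal_mul (by positivity), hm,
              ENNReal.ofReal_toReal isCompact_Icc.measure_lt_top.ne]
        _ ≤ 1 := by
            rw [ENNReal.ofReal_le_one, one_div_mul_eq_div]
            exact (div_le_one (by positivity)).2 (by linarith)
    calc C ≤ (|C| + 1) ^ 2 := by nlinarith [abs_nonneg C, le_abs_self C]
      _ = 1 / ε ^ 2 := by rw [hε_def]; field_simp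
      _ ≤ qstar μ x := by unfold qstar; gcongr

theorem finiteDimensional_of_goodSubspace {β : ℝ} (hβ : 0 ≤ β) {μp μm : Measure ℝ}
    [IsFiniteMeasureOnCompacts μp] (hμm : ∀ x : ℝ, μm (Icc x (x + 1)) ≤ ENNReal.ofReal β)
    (hμp : ∀ ε : ℝ, 0 < ε → ∀ᶠ x in cocompact ℝ,
      1 < ENNReal.ofReal ε * μp (Icc (x - ε / 2) (x + ε / 2)))
    {lam : ℝ} {L : Submodule ℂ (ℝ → ℂ)} (hL : GoodSubspace μp μm lam L) :
    FiniteDimensional ℂ L := by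
  set A : ℝ := |lam| + 2 * β * (4 * β + 1) + 1 with hA
  have hA1 : 1 ≤ A := le_add_of_nonneg_left (by positivity)
  set t : ℝ := 1 / (2 * A) with ht_def
  have ht : 0 < t := by positivity
  have htA : 4 * t ^ 2 * A ≤ 1 := by
    rw [ht_def]
    field_simp
    linarith
  have hfin : {k : ℤ | ¬ 1 ≤ ENNReal.ofReal t * μp (Ioc (k • t) ((k + 1) • t))}.Finite := by
    have hc : Tendsto (fun k : ℤ => k • t + t / 2) cofinite (cocompact ℝ) := by
      have h1 : Tendsto (fun k : ℤ => (k : ℝ)) cofinite (cocompact ℝ) :=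
        Int.isClosedEmbedding_coe_real.tendsto_cocompact.comp
          (by rw [cocompact_eq_cofinite]; exact tendsto_id)
      have h2 := (((Homeomorph.mulRight₀ t ht.ne').trans
        (Homeomorph.addRight (t / 2))).isClosedEmbedding.tendsto_cocompact).comp h1
      simpa [Function.comp_def] using h2
    have h := hc.eventually (hμp (t / 2) (by positivity))
    refine (eventually_cofinite.1 h).subset fun k hk hlt => hk (hlt.le.trans ?_)
    gcongr
    · linarith
    · intro z hz
      simp only [zsmul_eq_mul] at hz ⊢
      push_cast
      constructor <;> nlinarith [hz.1, hz.2]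
  set S := {k : ℤ | ¬ 1 ≤ ENNReal.ofReal t * μp (Ioc (k • t) ((k + 1) • t))}
  have : Finite S := hfin
  let ev : L →ₗ[ℂ] (S → ℂ) :=
    (LinearMap.pi fun k : S => LinearMap.proj ((k : ℤ) • t)).comp L.subtype
  refine FiniteDimensional.of_injective ev ((injective_iff_map_eq_zero ev).2 fun f hf => ?_)
  by_contra hne
  obtain ⟨g, H⟩ := hL.1 f f.2
  have hQ := hL.2 f f.2 (by simpa using hne) g H
  have hz : sqInt volume f.1 ≤ 2 * ENNReal.ofReal t ^ 2 * (sqInt μp f.1 + sqInt volume g) := by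
    refine H.sqInt_le_of_zero_or_one_le ht fun k => ?_
    by_cases hk : k ∈ S
    · exact Or.inl (congrFun hf ⟨k, hk⟩)
    · exact Or.inr (not_not.1 hk)
  have hz' := ENNReal.toReal_mono (by finiteness [H.f_mu.ne, H.g_L2.ne]) hz
  rw [ENNReal.toReal_mul, ENNReal.toReal_add H.f_mu.ne H.g_L2.ne] at hz'
  simp only [ENNReal.toReal_mul, ENNReal.toReal_pow, ENNReal.toReal_ofReal ht.le,
    ENNReal.toReal_ofNat] at hz'
  have hM := H.toReal_sqInt_le hβ hμm
  unfold formQ at hQ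
  have hN0 : 0 ≤ (sqInt volume f.1).toReal := ENNReal.toReal_nonneg
  have hP0 : 0 ≤ (sqInt μp f.1).toReal := ENNReal.toReal_nonneg
  set N := (sqInt volume f.1).toReal
  set G := (sqInt volume g).toReal
  set P := (sqInt μp f.1).toReal
  have hlam : lam * N ≤ |lam| * N := by gcongr; exact le_abs_self _
  have hlt : P + 1 / 2 * G < A * N := by rw [hA]; nlinarith
  have : N < N := calc
    N ≤ 2 * t ^ 2 * (P + G) := hz'
    _ ≤ 4 * t ^ 2 * (P + 1 / 2 * G) := by nlinarith [mul_nonneg (sq_nonneg t) hP0]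
    _ < 4 * t ^ 2 * (A * N) := by gcongr
    _ = 4 * t ^ 2 * A * N := by ring
    _ ≤ 1 * N := by gcongr
    _ = N := one_mul N
  exact this.false

theorem exists_separated_seq {p : ℝ → Prop} (hp : ∃ᶠ x in cocompact ℝ, p x) (r : ℝ) :
    ∃ u : ℕ → ℝ, (∀ n, p (u n)) ∧ Pairwise fun m n => r ≤ |u m - u n| := by
  have : Std.Symm fun x y : ℝ => r ≤ |x - y| := ⟨fun x y h => by rwa [abs_sub_comm]⟩
  refine exists_seq_of_forall_finset_exists' p (fun x y => r ≤ |x - y|) fun s _ => ?_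
  have hs : ∀ᶠ y in cocompact ℝ, ∀ x ∈ s, r ≤ |x - y| := by
    refine (eventually_all_finset s).2 fun x _ => ?_
    filter_upwards [(isCompact_Icc (a := x - r) (b := x + r)).compl_mem_cocompact] with y hy
    by_contra! hlt
    have := abs_lt.1 hlt
    exact hy (by constructor <;> linarith)
  exact (hp.and_eventually hs).exists

theorem sqInt_sum_smul (ν : Measure ℝ) {h : ℕ → ℝ → ℂ} (hm : ∀ n, Measurable (h n))
    (hd : ∀ x, Pairwise fun m n => h m x = 0 ∨ h n x = 0) (s : Finset ℕ) (c : ℕ → ℂ) :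
    sqInt ν (∑ n ∈ s, c n • h n) = ∑ n ∈ s, (‖c n‖₊ : ℝ≥0∞) ^ 2 * sqInt ν (h n) := by
  unfold sqInt
  simp_rw [← lintegral_const_mul _ ((hm _).nnnorm.coe_nnreal_ennreal.pow_const 2)]
  rw [← lintegral_finsetSum _ fun n _ =>
    ((hm n).nnnorm.coe_nnreal_ennreal.pow_const 2).const_mul _]
  refine lintegral_congr fun x => ?_
  simp only [Finset.sum_apply, Pi.smul_apply, smul_eq_mul]
  by_cases hx : ∃ m ∈ s, h m x ≠ 0
  · obtain ⟨m, hms, hmx⟩ := hx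
    have h0 : ∀ n, n ≠ m → h n x = 0 := fun n hn => (hd x hn).resolve_right hmx
    rw [Finset.sum_eq_single_of_mem m hms fun n _ hn => by simp [h0 n hn],
      Finset.sum_eq_single_of_mem m hms fun n _ hn => by simp [h0 n hn], nnnorm_mul,
      ENNReal.coe_mul, mul_pow]
  · push Not at hx
    rw [Finset.sum_eq_zero fun n hn => by simp [hx n hn],
      Finset.sum_eq_zero fun n hn => by simp [hx n hn]]
    simp

theorem sqInt_comp_sub_right (f : ℝ → ℂ) (a : ℝ) :
    sqInt volume (fun x => f (x - a)) = sqInt volume f :=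
  lintegral_sub_right_eq_self (fun x => (‖f x‖₊ : ℝ≥0∞) ^ 2) a

theorem sqInt_lt_top {f : ℝ → ℂ} (hf : Continuous f) (hc : HasCompactSupport f) (ν : Measure ℝ)
    [IsFiniteMeasureOnCompacts ν] : sqInt ν f < ⊤ := by
  have h := (hf.memLp_of_hasCompactSupport (p := 2) (μ := ν) hc)
  have h2 := lintegral_rpow_enorm_lt_top_of_eLpNorm_lt_top two_ne_zero ENNReal.ofNat_ne_top h.2
  simpa [sqInt, enorm] using h2

theorem memDom_deriv {μp : Measure ℝ} [IsFiniteMeasureOnCompacts μp] {f : ℝ → ℂ}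
    (hf : ContDiff ℝ 1 f) (hc : HasCompactSupport f) : MemDom μp f (deriv f) where
  locInt := (hf.continuous_deriv le_rfl).locallyIntegrable
  fund a b := (intervalIntegral.integral_deriv_eq_sub
    (fun _ _ => (hf.differentiable one_ne_zero).differentiableAt)
    ((hf.continuous_deriv le_rfl).intervalIntegrable a b)).symm
  f_L2 := sqInt_lt_top hf.continuous hc _
  g_L2 := sqInt_lt_top (hf.continuous_deriv le_rfl) hc.deriv _
  f_mu := sqInt_lt_top hf.continuous hc _

theorem exists_goodSubspace_not_finiteDimensional {μp μm : Measure ℝ}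
    [IsFiniteMeasureOnCompacts μp] {ε : ℝ} (hε : 0 < ε)
    (hμp : ∃ᶠ x in cocompact ℝ, ENNReal.ofReal ε * μp (Icc (x - ε / 2) (x + ε / 2)) ≤ 1) :
    ∃ lam : ℝ, ∃ L : Submodule ℂ (ℝ → ℂ), GoodSubspace μp μm lam L ∧ ¬ FiniteDimensional ℂ L := by
  obtain ⟨u, hu, hsep⟩ := exists_separated_seq hμp ε
  let b : ContDiffBump (0 : ℝ) := ⟨ε / 8, ε / 4, by positivity, by linarith⟩
  let φ : ℝ → ℂ := fun x => (b x : ℂ)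
  have hφ : ContDiff ℝ 1 φ := Complex.ofRealCLM.contDiff.comp b.contDiff
  have hφc : HasCompactSupport φ := b.hasCompactSupport.comp_left (g := Complex.ofReal) rfl
  have hφ_supp : tsupport φ ⊆ Metric.closedBall 0 (ε / 4) :=
    (closure_mono fun _ hx => by simpa [φ] using hx).trans b.tsupport_eq.subset
  have hφ0 : φ 0 = 1 := by
    simp [φ, b.one_of_mem_closedBall (Metric.mem_closedBall_self b.rIn_pos.le)]
  let h : ℕ → ℝ → ℂ := fun n x => φ (x - u n)
  let h' : ℕ → ℝ → ℂ := fun n x => deriv φ (x - u n)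
  have hh : ∀ n, ContDiff ℝ 1 (h n) := fun n => hφ.comp (contDiff_id.sub contDiff_const)
  have hhc : ∀ n, HasCompactSupport (h n) := fun n =>
    hφc.comp_homeomorph (Homeomorph.subRight (u n))
  have hh_deriv : ∀ n, deriv (h n) = h' n := fun n => funext fun x => deriv_comp_sub_const _ _ _
  have hsupp : ∀ n x, x - u n ∈ tsupport φ → |x - u n| ≤ ε / 4 := fun n x hx => by
    simpa using hφ_supp hx
  have hdisj : ∀ x, Pairwise fun m n => x - u m ∉ tsupport φ ∨ x - u n ∉ tsupport φ := by
    intro x m n hmn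
    by_contra! hcon
    have h1 := abs_le.1 (hsupp m x hcon.1)
    have h2 := abs_le.1 (hsupp n x hcon.2)
    have h3 : |u m - u n| ≤ ε / 2 := abs_le.2 ⟨by linarith, by linarith⟩
    linarith [hsep hmn]
  have hd : ∀ x, Pairwise fun m n => h m x = 0 ∨ h n x = 0 := fun x m n hmn =>
    (hdisj x hmn).imp (image_eq_zero_of_notMem_tsupport (f := φ))
      (image_eq_zero_of_notMem_tsupport (f := φ))
  have hd' : ∀ x, Pairwise fun m n => h' m x = 0 ∨ h' n x = 0 := fun x m n hmn =>
    (hdisj x hmn).imp (fun hx => Function.notMem_support.1 fun hx' => hx (support_deriv_subset hx'))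
      (fun hx => Function.notMem_support.1 fun hx' => hx (support_deriv_subset hx'))
  have hdiag : ∀ n, h n (u n) = 1 := fun n => by simp [h, hφ0]
  have hoff : ∀ m n, m ≠ n → h m (u n) = 0 := fun m n hmn =>
    (hd (u n) hmn).resolve_right (by simp [hdiag])
  have hli : LinearIndependent ℂ h := by
    refine linearIndependent_iff'.2 fun s c hc n hn => ?_
    have := congrFun hc (u n)
    rw [Finset.sum_apply, Finset.sum_eq_single_of_mem n hn fun m _ hm => by
      simp [hoff m n hm]] at this
    simpa [hdiag] using this
  have hP : ∀ n, sqInt μp (h n) ≤ ENNReal.ofReal (1 / ε) := by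
    intro n
    calc sqInt μp (h n) ≤ ∫⁻ x, (Icc (u n - ε / 2) (u n + ε / 2)).indicator 1 x ∂μp := by
          refine lintegral_mono fun x => ?_
          by_cases hx : x - u n ∈ tsupport φ
          · have := abs_le.1 (hsupp n x hx)
            rw [indicator_of_mem (by constructor <;> linarith)]
            have hle : ‖h n x‖₊ ≤ 1 := by
              rw [← NNReal.coe_le_coe]
              simpa [h, φ, abs_of_nonneg b.nonneg] using b.le_one
            simpa using pow_le_one' (ENNReal.coe_le_one_iff.2 hle) 2
          · have : h n x = 0 := image_eq_zero_of_notMem_tsupport (f := φ) hx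
            simp [this]
      _ = μp (Icc (u n - ε / 2) (u n + ε / 2)) := lintegral_indicator_one measurableSet_Icc
      _ ≤ (ENNReal.ofReal ε)⁻¹ := by
          rw [ENNReal.le_inv_iff_mul_le, mul_comm]; exact hu n
      _ = _ := by rw [one_div, ENNReal.ofReal_inv_of_pos hε]
  have hNtop := sqInt_lt_top hφ.continuous hφc volume
  have hGtop := sqInt_lt_top (hφ.continuous_deriv le_rfl) hφc.deriv volume
  set N₀ := sqInt volume φ with hN₀
  set G₀ := sqInt volume (deriv φ) with hG₀
  have hN0 : N₀ ≠ 0 := by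
    intro h0
    have hae : φ =ᵐ[volume] 0 := by
      filter_upwards [(lintegral_eq_zero_iff
        (hφ.continuous.measurable.nnnorm.coe_nnreal_ennreal.pow_const 2)).1 h0] with x hx
      simpa using hx
    have := congrFun ((hφ.continuous.ae_eq_iff_eq volume continuous_zero).1 hae) 0
    exact one_ne_zero (hφ0.symm.trans this)
  have hN0' : 0 < N₀.toReal := ENNReal.toReal_pos hN0 hNtop.ne
  have hrep : ∀ f ∈ Submodule.span ℂ (range h), ∃ c : ℕ →₀ ℂ, f = ∑ n ∈ c.support, c n • h n := by
    intro f hf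
    obtain ⟨c, rfl⟩ := (Finsupp.mem_span_range_iff_exists_finsupp).1 hf
    exact ⟨c, rfl⟩
  have hdom : ∀ c : ℕ →₀ ℂ, MemDom μp (∑ n ∈ c.support, c n • h n)
      (∑ n ∈ c.support, c n • h' n) := by
    intro c
    have hcd : ContDiff ℝ 1 (∑ n ∈ c.support, c n • h n) :=
      Finset.sum_induction _ (ContDiff ℝ 1) (fun _ _ => ContDiff.add) contDiff_const
        fun n _ => contDiff_const.smul (hh n)
    have hcs : HasCompactSupport (∑ n ∈ c.support, c n • h n) :=
      Finset.sum_induction _ HasCompactSupport (fun _ _ => HasCompactSupport.add) .zero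
        fun n _ => (hhc n).comp_left (g := fun z => c n * z) (mul_zero _)
    have hder : deriv (∑ n ∈ c.support, c n • h n) = ∑ n ∈ c.support, c n • h' n := by
      funext x
      have hdiff : ∀ n, DifferentiableAt ℝ (h n) x := fun n =>
        ((hh n).differentiable one_ne_zero).differentiableAt
      rw [deriv_sum fun n _ => (hdiff n).const_smul (c n), Finset.sum_apply]
      refine Finset.sum_congr rfl fun n _ => ?_
      rw [deriv_const_smul _ (hdiff n), hh_deriv, Pi.smul_apply]
    exact hder ▸ memDom_deriv hcd hcs
  refine ⟨(G₀.toReal + 1 / ε + 1) / N₀.toReal, Submodule.span ℂ (range h), ⟨?_, ?_⟩, ?_⟩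
  · intro f hf
    obtain ⟨c, rfl⟩ := hrep f hf
    exact ⟨_, hdom c⟩
  · intro f hf hne g hg
    obtain ⟨c, rfl⟩ := hrep f hf
    have hNf := sqInt_sum_smul volume (fun n => (hh n).continuous.measurable) hd c.support c
    have hPf := sqInt_sum_smul μp (fun n => (hh n).continuous.measurable) hd c.support c
    have hGf := sqInt_sum_smul volume (h := h') (fun n => hh_deriv n ▸
      ((hh n).continuous_deriv le_rfl).measurable) hd' c.support c
    rw [← hg.sqInt_deriv_congr (hdom c)] at hGf
    set f := ∑ n ∈ c.support, c n • h n
    set K : ℝ≥0∞ := ∑ n ∈ c.support, (‖c n‖₊ : ℝ≥0∞) ^ 2 with hK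
    have hKtop : K ≠ ⊤ := by simp [hK]
    simp only [h, h', sqInt_comp_sub_right, ← Finset.sum_mul] at hNf hGf
    have hPle : sqInt μp f ≤ K * ENNReal.ofReal (1 / ε) := by
      rw [hPf, hK, Finset.sum_mul]
      gcongr
      exact hP _
    have hPle' := ENNReal.toReal_mono (by finiteness) hPle
    have hK0 : 0 < K.toReal := by
      refine ENNReal.toReal_pos (fun h0 => hne ?_) hKtop
      refine Finset.sum_eq_zero fun n hn => ?_
      exact absurd ((Finset.sum_eq_zero_iff.1 h0) n hn) (by simpa using hn)
    rw [ENNReal.toReal_mul, ENNReal.toReal_ofReal (by positivity)] at hPle'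
    unfold formQ
    rw [hNf, hGf, ENNReal.toReal_mul, ENNReal.toReal_mul]
    have hM : 0 ≤ (sqInt μm f).toReal := ENNReal.toReal_nonneg
    calc _ ≤ K.toReal * G₀.toReal + K.toReal * (1 / ε) := by linarith
      _ < K.toReal * (G₀.toReal + 1 / ε + 1) := by linarith
      _ = _ := by rw [← hN₀, ← hK]; field_simp
  · intro hfd
    exact (Module.Finite.finite_basis (Module.Basis.span hli)).false

/-- Discreteness criterion: for `μ = μ₊ − μ₋ ∈ 𝔐_β`, the spectrum of `H_μ` is purely
discrete (equivalently, for every `λ` each linear subspace `L ⊆ D(a_μ)` with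
`a_μ(f, f) < λ‖f‖²` for all nonzero `f ∈ L` is finite-dimensional) if and only if
`q*_{μ₊}(x) → ∞` as `|x| → ∞`. -/
theorem discreteness_criterion (β : ℝ) (hβ : 0 ≤ β)
    (μp μm : Measure ℝ) [μp.Regular] [μm.Regular]
    (hμp : μp univ ≠ 0)
    (hμm : ∀ x : ℝ, μm (Icc x (x + 1)) ≤ ENNReal.ofReal β) :
    (∀ lam : ℝ, ∀ L : Submodule ℂ (ℝ → ℂ), GoodSubspace μp μm lam L →
        FiniteDimensional ℂ ↥L) ↔
      Tendsto (qstar μp) (cocompact ℝ) atTop := by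
  rw [tendsto_qstar_iff μp hμp]
  refine ⟨fun h ε hε => ?_, fun h lam L hL => finiteDimensional_of_goodSubspace hβ hμm h hL⟩
  by_contra hcon
  have hfreq : ∃ᶠ x in cocompact ℝ, ENNReal.ofReal ε * μp (Icc (x - ε / 2) (x + ε / 2)) ≤ 1 :=
    (not_eventually.1 hcon).mono fun x hx => not_lt.1 hx
  obtain ⟨lam, L, hL, hfd⟩ := exists_goodSubspace_not_finiteDimensional (μm := μm) hε hfreq
  exact hfd (h lam L hL)
end

section
/- Let β ≥ 0, μ = μ₊ − μ₋ ∈ 𝔐_β, and let l > 0 and α ≥ 0 be constants such that μ₋(I) ≥ α for every interval I ⊂ ℝ of length at least l. Set q₀* = inf_{x ∈ ℝ} q*_{μ₊}(x). Then the infimum over all nonzero f ∈ D(a_μ) of a_μ(f, f)/‖f‖² is at most (8/3)·(π² + 1)·(αl + 2)·q₀* − α/(2l). (Equivalently, the lower bound λ₁ of the spectrum of the operator H_μ associated with a_μ satisfies λ₁ ≤ (8/3)·(π² + 1)·(αl + 2)·q₀* − α/(2l).) -/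
open MeasureTheory Set Filter ENNReal

/-- The tent function of height and half-width `h` centred at `c`. -/
noncomputable def tent (c h t : ℝ) : ℝ := max 0 (h - |t - c|)

/-- The almost everywhere derivative of the tent function. -/
noncomputable def tentDeriv (c h : ℝ) : ℝ → ℝ :=
  (Ioo (c - h) (c + h)).indicator fun t => if t < c then 1 else -1

lemma tent_nonneg (c h t : ℝ) : 0 ≤ tent c h t := le_max_left _ _

lemma tent_le {c h t : ℝ} (hh : 0 ≤ h) : tent c h t ≤ h :=
  max_le hh (by linarith [abs_nonneg (t - c)])

lemma tent_eq_zero {c h t : ℝ} (ht : t ∉ Icc (c - h) (c + h)) : tent c h t = 0 := by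
  refine max_eq_left ?_
  by_contra! hlt
  have := abs_lt.1 (by linarith : |t - c| < h)
  exact ht ⟨by linarith [this.1], by linarith [this.2]⟩

lemma continuous_tent (c h : ℝ) : Continuous (tent c h) := by
  unfold tent
  fun_prop

lemma tent_sub_le (c h s t : ℝ) : tent c h s - |s - t| ≤ tent c h t := by
  have h1 : |t - c| ≤ |s - t| + |s - c| := by
    have := abs_sub_le t s c
    rwa [abs_sub_comm t s] at this
  have h2 : h - |t - c| ≤ tent c h t := le_max_right _ _
  have h3 := tent_nonneg c h t
  have h4 := abs_nonneg (s - t)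
  rcases max_choice 0 (h - |s - c|) with h5 | h5 <;>
  · change tent c h s = _ at h5
    linarith

lemma integral_tent_pow {c h : ℝ} (hh : 0 ≤ h) {n : ℕ} (hn : n ≠ 0) :
    ∫ t, tent c h t ^ n = 2 * (h ^ (n + 1) / (n + 1)) := by
  have h1 : ∫ t, tent c h t ^ n = ∫ t, (fun s => max 0 (h - s) ^ n) |t| :=
    integral_sub_right_eq_self (fun t => max 0 (h - |t|) ^ n) c
  have h2 : ∫ s in Ioi (0 : ℝ), max 0 (h - s) ^ n = ∫ s in Ioc 0 h, max 0 (h - s) ^ n := by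
    refine (setIntegral_eq_of_subset_of_forall_sdiff_eq_zero measurableSet_Ioi
      (fun s hs => hs.1) fun s hs => ?_)
    have : h ≤ s := by
      by_contra! hlt
      exact hs.2 ⟨hs.1, hlt.le⟩
    rw [max_eq_left (by linarith), zero_pow hn]
  have h3 : ∫ s in Ioc 0 h, max 0 (h - s) ^ n = ∫ s in (0 : ℝ)..h, (h - s) ^ n := by
    rw [intervalIntegral.integral_of_le hh]
    refine setIntegral_congr_fun measurableSet_Ioc fun s hs => ?_
    rw [max_eq_right (by linarith [hs.2])]
  rw [h1, integral_comp_abs (f := fun s => max 0 (h - s) ^ n), h2, h3,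
    intervalIntegral.integral_comp_sub_left (fun s => s ^ n) h]
  simp

lemma integrable_tent_pow (c h : ℝ) {n : ℕ} (hn : n ≠ 0) :
    Integrable fun t => tent c h t ^ n := by
  have hc : Continuous fun t => tent c h t ^ n := (continuous_tent c h).pow n
  refine hc.integrable_of_hasCompactSupport
    (HasCompactSupport.intro (isCompact_Icc (a := c - h) (b := c + h)) fun t ht => ?_)
  rw [tent_eq_zero ht, zero_pow hn]

lemma hasDerivAt_tent {c h t : ℝ} (ht : t ∉ ({c - h, c, c + h} : Set ℝ)) :
    HasDerivAt (tent c h) (tentDeriv c h t) t := by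
  simp only [mem_insert_iff, mem_singleton_iff, not_or] at ht
  obtain ⟨h1, h2, h3⟩ := ht
  by_cases hm : t ∈ Ioo (c - h) (c + h)
  · rw [tentDeriv, indicator_of_mem hm]
    rcases lt_or_gt_of_ne h2 with hlt | hgt
    · rw [if_pos hlt]
      refine ((hasDerivAt_id t).add_const (h - c)).congr_of_eventuallyEq ?_
      filter_upwards [Ioo_mem_nhds hm.1 hlt] with s hs
      rw [tent, abs_of_neg (by linarith [hs.2]), max_eq_right (by linarith [hs.1])]
      simp only [id]
      ring
    · rw [if_neg hgt.not_gt]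
      refine ((hasDerivAt_id t).neg.add_const (h + c)).congr_of_eventuallyEq ?_
      filter_upwards [Ioo_mem_nhds hgt hm.2] with s hs
      rw [tent, abs_of_pos (by linarith [hs.1]), max_eq_right (by linarith [hs.2])]
      simp only [id, Pi.neg_apply]
      ring
  · rw [tentDeriv, indicator_of_notMem hm]
    refine (hasDerivAt_const t (0 : ℝ)).congr_of_eventuallyEq ?_
    have hc : t ∈ (Icc (c - h) (c + h))ᶜ := fun hI =>
      hm ⟨lt_of_le_of_ne hI.1 (Ne.symm h1), lt_of_le_of_ne hI.2 h3⟩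
    filter_upwards [isClosed_Icc.isOpen_compl.mem_nhds hc] with s hs using tent_eq_zero hs

lemma measurable_tentDeriv (c h : ℝ) : Measurable (tentDeriv c h) :=
  (Measurable.ite measurableSet_Iio measurable_const measurable_const).indicator
    measurableSet_Ioo

lemma abs_tentDeriv_le (c h t : ℝ) :
    |tentDeriv c h t| ≤ (Icc (c - h) (c + h)).indicator (fun _ => (1 : ℝ)) t := by
  by_cases hm : t ∈ Ioo (c - h) (c + h)
  · rw [tentDeriv, indicator_of_mem hm, indicator_of_mem (Ioo_subset_Icc_self hm)]
    split_ifs <;> simp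
  · rw [tentDeriv, indicator_of_notMem hm, abs_zero]
    exact indicator_nonneg (fun _ _ => zero_le_one) t

lemma integrable_tentDeriv (c h : ℝ) : Integrable (tentDeriv c h) := by
  have hi : Integrable ((Icc (c - h) (c + h)).indicator fun _ => (1 : ℝ)) :=
    (integrable_indicator_iff measurableSet_Icc).2 (integrableOn_const (by simp))
  exact hi.mono' (measurable_tentDeriv c h).aestronglyMeasurable
    (ae_of_all _ (abs_tentDeriv_le c h))

lemma tent_sub_tent (c h a b : ℝ) :
    tent c h b - tent c h a = ∫ t in a..b, tentDeriv c h t :=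
  (integral_eq_of_hasDerivAt_off_countable (tent c h) (tentDeriv c h)
    (s := {c - h, c, c + h}) (Set.toFinite _).countable (continuous_tent c h).continuousOn
    (fun _ ht => hasDerivAt_tent ht.2)
    (integrable_tentDeriv c h).intervalIntegrable).symm

lemma sqInt_ofReal (ν : Measure ℝ) (u : ℝ → ℝ) :
    sqInt ν (fun t => (u t : ℂ)) = ∫⁻ t, ENNReal.ofReal (u t ^ 2) ∂ν := by
  refine lintegral_congr fun t => ?_
  rw [← enorm_eq_nnnorm, ← ofReal_norm, Complex.norm_real, Real.norm_eq_abs,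
    ← ENNReal.ofReal_pow (abs_nonneg _), sq_abs]

lemma sqInt_ofReal_le {ν : Measure ℝ} {u : ℝ → ℝ} {I : Set ℝ} (hI : MeasurableSet I) {M : ℝ}
    (hu : ∀ t, |u t| ≤ I.indicator (fun _ => M) t) :
    sqInt ν (fun t => (u t : ℂ)) ≤ ENNReal.ofReal (M ^ 2) * ν I := by
  rw [sqInt_ofReal, ← lintegral_indicator_const hI]
  refine lintegral_mono fun t => ?_
  have := hu t
  by_cases ht : t ∈ I
  · rw [indicator_of_mem ht] at this ⊢
    exact ENNReal.ofReal_le_ofReal (sq_le_sq' (abs_le.1 this).1 (abs_le.1 this).2)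
  · rw [indicator_of_notMem ht] at this ⊢
    simp [abs_nonpos_iff.1 this]

lemma abs_tent_le {c h : ℝ} (hh : 0 ≤ h) (t : ℝ) :
    |tent c h t| ≤ (Icc (c - h) (c + h)).indicator (fun _ => h) t := by
  rw [abs_of_nonneg (tent_nonneg c h t)]
  by_cases ht : t ∈ Icc (c - h) (c + h)
  · rw [indicator_of_mem ht]
    exact tent_le hh
  · rw [indicator_of_notMem ht, tent_eq_zero ht]

lemma sqInt_tent_le (ν : Measure ℝ) {c h : ℝ} (hh : 0 ≤ h) :
    sqInt ν (fun t => (tent c h t : ℂ)) ≤ ENNReal.ofReal (h ^ 2) * ν (Icc (c - h) (c + h)) :=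
  sqInt_ofReal_le measurableSet_Icc (abs_tent_le hh)

lemma sqInt_tent_lt_top (ν : Measure ℝ) [IsFiniteMeasureOnCompacts ν] {c h : ℝ} (hh : 0 ≤ h) :
    sqInt ν (fun t => (tent c h t : ℂ)) < ⊤ :=
  (sqInt_tent_le ν hh).trans_lt (ENNReal.mul_lt_top ofReal_lt_top isCompact_Icc.measure_lt_top)

lemma sqInt_tentDeriv_le {c h : ℝ} :
    sqInt volume (fun t => (tentDeriv c h t : ℂ)) ≤ ENNReal.ofReal (2 * h) := by
  refine (sqInt_ofReal_le measurableSet_Icc (abs_tentDeriv_le c h)).trans_eq ?_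
  rw [Real.volume_Icc, one_pow, ENNReal.ofReal_one, one_mul]
  congr 1
  ring

lemma toReal_sqInt_volume_tent {c h : ℝ} (hh : 0 ≤ h) :
    (sqInt volume (fun t => (tent c h t : ℂ))).toReal = 2 * h ^ 3 / 3 := by
  rw [sqInt_ofReal, ← integral_eq_lintegral_of_nonneg_ae (ae_of_all _ fun _ => sq_nonneg _)
    ((continuous_tent c h).pow 2).aestronglyMeasurable, integral_tent_pow hh two_ne_zero]
  push_cast
  ring

lemma memDom_tent (μ : Measure ℝ) [IsFiniteMeasureOnCompacts μ] {c h : ℝ} (hh : 0 < h) :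
    MemDom μ (fun t => (tent c h t : ℂ)) (fun t => (tentDeriv c h t : ℂ)) where
  locInt := (integrable_tentDeriv c h).ofReal.locallyIntegrable
  fund a b := by
    rw [intervalIntegral.integral_ofReal, ← tent_sub_tent, Complex.ofReal_sub]
  f_L2 := sqInt_tent_lt_top _ hh.le
  g_L2 := sqInt_tentDeriv_le.trans_lt ofReal_lt_top
  f_mu := sqInt_tent_lt_top _ hh.le

/-- Averaging the lower bound `α ≤ ν [y, y + l]` against a weight `F`. -/
lemma mul_lintegral_le_of_le_measure_Icc {ν : Measure ℝ} [SFinite ν] {l : ℝ} {A : ℝ≥0∞}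
    (hν : ∀ y, A ≤ ν (Icc y (y + l))) {F G : ℝ → ℝ≥0∞} (hF : Measurable F)
    (hG : Measurable G) (hFG : ∀ y t, y ≤ t → t ≤ y + l → F y ≤ G t) :
    A * ∫⁻ y, F y ≤ ENNReal.ofReal l * ∫⁻ t, G t ∂ν := by
  have hS : MeasurableSet {p : ℝ × ℝ | p.1 ≤ p.2 ∧ p.2 ≤ p.1 + l} :=
    (measurableSet_le measurable_fst measurable_snd).inter
      (measurableSet_le measurable_snd (measurable_fst.add_const l))
  calc A * ∫⁻ y, F y = ∫⁻ y, A * F y := (lintegral_const_mul A hF).symm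
    _ ≤ ∫⁻ y, ∫⁻ t, {p : ℝ × ℝ | p.1 ≤ p.2 ∧ p.2 ≤ p.1 + l}.indicator
          (fun p => F p.1) (y, t) ∂ν := by
        refine lintegral_mono fun y => ?_
        have : ∀ t, {p : ℝ × ℝ | p.1 ≤ p.2 ∧ p.2 ≤ p.1 + l}.indicator
            (fun p => F p.1) (y, t) = (Icc y (y + l)).indicator (fun _ => F y) t := fun t => rfl
        simp only [this]
        rw [lintegral_indicator_const measurableSet_Icc, mul_comm]
        gcongr
        exact hν y
    _ = ∫⁻ t, (∫⁻ y, {p : ℝ × ℝ | p.1 ≤ p.2 ∧ p.2 ≤ p.1 + l}.indicator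
          (fun p => F p.1) (y, t)) ∂ν := by
        exact lintegral_lintegral_swap (((hF.comp measurable_fst).indicator hS).aemeasurable)
    _ ≤ ∫⁻ t, ENNReal.ofReal l * G t ∂ν := by
        refine lintegral_mono fun t => ?_
        simp only
        calc _ ≤ ∫⁻ y, (Icc (t - l) t).indicator (fun _ => G t) y := by
              refine lintegral_mono fun y => indicator_apply_le' (fun hy => ?_) fun _ => zero_le
              have hy : y ≤ t ∧ t ≤ y + l := hy
              have hyt : y ∈ Icc (t - l) t := ⟨by linarith [hy.2], hy.1⟩
              rw [indicator_of_mem hyt]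
              exact hFG y t hy.1 hy.2
          _ = _ := by
              rw [lintegral_indicator_const measurableSet_Icc, Real.volume_Icc, mul_comm]
              congr 2
              ring
    _ = _ := lintegral_const_mul _ hG

/-- Mass lower bounds for `ν` on intervals of length `l` bound `∫ |f|² dν` from below for
a tent `f` that is wide compared with `l`. -/
lemma le_toReal_sqInt_tent {ν : Measure ℝ} [IsLocallyFiniteMeasure ν] {l α : ℝ} (hl : 0 < l)
    (hα : 0 ≤ α) (hν : ∀ y, ENNReal.ofReal α ≤ ν (Icc y (y + l))) {c h : ℝ}
    (hh : 3 * l ≤ h) :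
    α * h ^ 3 / (3 * l) ≤ (sqInt ν (fun t => (tent c h t : ℂ))).toReal := by
  have hh0 : 0 ≤ h := by linarith
  set F : ℝ → ℝ := fun y => tent c h (y + l / 2) ^ 2 - l * tent c h (y + l / 2) ^ 1 with hFdef
  have hFc : Continuous F := by
    have := continuous_tent c h
    fun_prop
  have hFint : ∫ y, F y = 2 * h ^ 3 / 3 - l * h ^ 2 := by
    rw [hFdef, integral_add_right_eq_self (fun y => tent c h y ^ 2 - l * tent c h y ^ 1),
      integral_sub (integrable_tent_pow c h two_ne_zero)
        ((integrable_tent_pow c h one_ne_zero).const_mul l), integral_const_mul,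
      integral_tent_pow hh0 two_ne_zero, integral_tent_pow hh0 one_ne_zero]
    push_cast
    ring
  have hF : Integrable F :=
    ((integrable_tent_pow c h two_ne_zero).sub
      ((integrable_tent_pow c h one_ne_zero).const_mul l)).comp_add_right (l / 2)
  have hle : ∀ y t, y ≤ t → t ≤ y + l →
      ENNReal.ofReal (F y) ≤ ENNReal.ofReal (tent c h t ^ 2) := by
    intro y t h1 h2
    refine ENNReal.ofReal_le_ofReal ?_
    have h3 : |y + l / 2 - t| ≤ l / 2 := abs_le.2 ⟨by linarith, by linarith⟩
    have h4 := tent_sub_le c h (y + l / 2) t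
    have h5 := tent_nonneg c h t
    have h6 := tent_nonneg c h (y + l / 2)
    simp only [hFdef, pow_one]
    rcases le_total (l / 2) (tent c h (y + l / 2)) with h7 | h7 <;> nlinarith
  have key := mul_lintegral_le_of_le_measure_Icc hν hFc.measurable.ennreal_ofReal
    ((continuous_tent c h).measurable.pow_const 2).ennreal_ofReal hle
  rw [← sqInt_ofReal] at key
  have hlow : ENNReal.ofReal (∫ y, F y) ≤ ∫⁻ y, ENNReal.ofReal (F y) := by
    rw [integral_eq_lintegral_pos_part_sub_lintegral_neg_part hF]
    refine (ENNReal.ofReal_le_ofReal (sub_le_self _ toReal_nonneg)).trans ofReal_toReal_le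
  have h1 : ENNReal.ofReal (α * ∫ y, F y) ≤
      ENNReal.ofReal l * sqInt ν (fun t => (tent c h t : ℂ)) := by
    rw [ENNReal.ofReal_mul hα]
    exact (mul_le_mul_right hlow _).trans key
  have h2 := (ofReal_le_iff_le_toReal
    (ENNReal.mul_ne_top ofReal_ne_top (sqInt_tent_lt_top ν hh0).ne)).1 h1
  rw [toReal_mul, toReal_ofReal hl.le, hFint] at h2
  rw [div_le_iff₀ (by positivity)]
  have h3 : 0 ≤ α * (h ^ 2 * (h - 3 * l)) :=
    mul_nonneg hα (mul_nonneg (sq_nonneg h) (by linarith))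
  nlinarith

lemma qstar_nonneg (μ : Measure ℝ) (x : ℝ) : 0 ≤ qstar μ x :=
  div_nonneg zero_le_one (sq_nonneg _)

lemma exists_pos_mem_dFun_set (μ : Measure ℝ) [IsFiniteMeasureOnCompacts μ] (x : ℝ) :
    ∃ d : ℝ, 0 < d ∧ ENNReal.ofReal d * μ (Icc (x - d / 2) (x + d / 2)) ≤ 1 := by
  set m := (μ (Icc (x - 1) (x + 1))).toReal with hm
  have hm0 : 0 ≤ m := toReal_nonneg
  have hd : 0 < 1 / (m + 1) := by positivity
  have hd1 : 1 / (m + 1) ≤ 1 := by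
    rw [div_le_one (by linarith)]
    linarith
  refine ⟨1 / (m + 1), hd, ?_⟩
  calc _ ≤ ENNReal.ofReal (1 / (m + 1)) * ENNReal.ofReal m := by
        rw [hm, ofReal_toReal isCompact_Icc.measure_lt_top.ne]
        gcongr <;> linarith
    _ = ENNReal.ofReal (1 / (m + 1) * m) := (ENNReal.ofReal_mul hd.le).symm
    _ ≤ 1 := by
        rw [ENNReal.ofReal_le_one, one_div_mul_eq_div, div_le_one (by linarith)]
        linarith

lemma exists_one_div_sq_lt (μ : Measure ℝ) [IsFiniteMeasureOnCompacts μ] {x q : ℝ}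
    (hq : qstar μ x < q) :
    ∃ d : ℝ, 0 < d ∧ ENNReal.ofReal d * μ (Icc (x - d / 2) (x + d / 2)) ≤ 1 ∧
      1 / d ^ 2 < q := by
  have hq0 : 0 < q := (qstar_nonneg μ x).trans_lt hq
  have hs : 0 < 1 / √q := by positivity
  have hfin : ∀ d, 1 / √q < d → 1 / d ^ 2 < q := by
    intro d hd
    have hd0 : 0 < d := hs.trans hd
    rw [div_lt_iff₀ (Real.sqrt_pos.2 hq0)] at hd
    rw [div_lt_iff₀ (by positivity)]
    nlinarith [Real.sq_sqrt hq0.le]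
  suffices h : ∃ d ∈ {d : ℝ | 0 ≤ d ∧ ENNReal.ofReal d * μ (Icc (x - d / 2) (x + d / 2)) ≤ 1},
      1 / √q < d by
    obtain ⟨d, hd, hlt⟩ := h
    exact ⟨d, hs.trans hlt, hd.2, hfin d hlt⟩
  by_cases hb : BddAbove
      {d : ℝ | 0 ≤ d ∧ ENNReal.ofReal d * μ (Icc (x - d / 2) (x + d / 2)) ≤ 1}
  · obtain ⟨d, hd0, hd⟩ := exists_pos_mem_dFun_set μ x
    have hD : 0 < dFun μ x := hd0.trans_le (le_csSup hb ⟨hd0.le, hd⟩)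
    refine exists_lt_of_lt_csSup ⟨d, hd0.le, hd⟩ (?_ : 1 / √q < dFun μ x)
    rw [qstar, div_lt_iff₀ (by positivity)] at hq
    rw [div_lt_iff₀ (Real.sqrt_pos.2 hq0)]
    refine lt_of_pow_lt_pow_left₀ 2 (by positivity) ?_
    rw [mul_pow, Real.sq_sqrt hq0.le]
    linarith
  · rw [not_bddAbove_iff] at hb
    exact hb _

lemma exists_one_div_sq_lt_of_iInf_lt (μ : Measure ℝ) [IsFiniteMeasureOnCompacts μ] {q : ℝ}
    (hq : ⨅ x : ℝ, qstar μ x < q) :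
    ∃ x d : ℝ, 0 < d ∧ ENNReal.ofReal d * μ (Icc (x - d / 2) (x + d / 2)) ≤ 1 ∧
      1 / d ^ 2 < q :=
  let ⟨x, hx⟩ := exists_lt_of_ciInf_lt hq
  ⟨x, exists_one_div_sq_lt μ hx⟩

lemma formQ_tent_le {μp μm : Measure ℝ} [IsLocallyFiniteMeasure μm] {l α : ℝ} (hl : 0 < l)
    (hα : 0 ≤ α) (hμm : ∀ y, ENNReal.ofReal α ≤ μm (Icc y (y + l))) {c h : ℝ} (hh : 0 < h)
    (hμp : ENNReal.ofReal (2 * h) * μp (Icc (c - h) (c + h)) ≤ 1) :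
    formQ μp μm (fun t => (tent c h t : ℂ)) (fun t => (tentDeriv c h t : ℂ)) ≤
      (8 / 3 * (Real.pi ^ 2 + 1) * (α * l + 2) * (1 / (2 * h) ^ 2) - α / (2 * l)) *
        (2 * h ^ 3 / 3) := by
  have hg : (sqInt volume (fun t => (tentDeriv c h t : ℂ))).toReal ≤ 2 * h :=
    toReal_le_of_le_ofReal (by linarith) sqInt_tentDeriv_le
  have hp : (sqInt μp (fun t => (tent c h t : ℂ))).toReal ≤ h / 2 := by
    refine toReal_le_of_le_ofReal (by linarith) ((sqInt_tent_le μp hh.le).trans ?_)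
    calc ENNReal.ofReal (h ^ 2) * μp (Icc (c - h) (c + h))
        = ENNReal.ofReal (h / 2) * (ENNReal.ofReal (2 * h) * μp (Icc (c - h) (c + h))) := by
          rw [← mul_assoc, ← ENNReal.ofReal_mul (by linarith)]
          congr 2
          ring
      _ ≤ ENNReal.ofReal (h / 2) * 1 := by gcongr
      _ = _ := mul_one _
  have hpi : 9 ≤ Real.pi ^ 2 := by nlinarith [Real.pi_gt_three]
  have hrhs : (8 / 3 * (Real.pi ^ 2 + 1) * (α * l + 2) * (1 / (2 * h) ^ 2) - α / (2 * l)) *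
        (2 * h ^ 3 / 3) =
      4 / 9 * (Real.pi ^ 2 + 1) * (α * l + 2) * h - α * h ^ 3 / (3 * l) := by
    field_simp
    ring
  have hαl : 0 ≤ α * l * h := by positivity
  have hK : 40 / 9 * (α * l * h + 2 * h) ≤ 4 / 9 * (Real.pi ^ 2 + 1) * (α * l + 2) * h := by
    nlinarith [mul_nonneg (sub_nonneg.2 hpi) (by linarith : 0 ≤ α * l * h + 2 * h)]
  rw [hrhs, formQ]
  rcases le_total (3 * l) h with hlh | hlh
  · linarith [le_toReal_sqInt_tent (c := c) hl hα hμm hlh]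
  · have h1 : α * h ^ 3 / (3 * l) ≤ 3 * (α * l * h) := by
      rw [div_le_iff₀ (by positivity)]
      have : h ^ 2 ≤ 9 * l ^ 2 := by nlinarith
      nlinarith [mul_le_mul_of_nonneg_left this (by positivity : 0 ≤ α * h)]
    linarith [toReal_nonneg (a := sqInt μm (fun t => (tent c h t : ℂ)))]

/-- Upper bound for the bottom of the spectrum: for `μ = μ₊ − μ₋ ∈ 𝔐_β`, with constants
`l > 0`, `α ≥ 0` such that `μ₋(I) ≥ α` for every interval `I` of length at least `l`,
and `q₀* = inf_x q*_{μ₊}(x)`, the infimum over nonzero `f ∈ D(a_μ)` of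
`a_μ(f, f)/‖f‖²` is at most `(8/3)·(π² + 1)·(αl + 2)·q₀* − α/(2l)`; that is, for every
`ε > 0` there is a nonzero `f ∈ D(a_μ)` with
`a_μ(f, f) < ((8/3)·(π² + 1)·(αl + 2)·q₀* − α/(2l) + ε)·‖f‖²`. -/
theorem bottom_spectrum_upper_bound (β : ℝ) (hβ : 0 ≤ β)
    (μp μm : Measure ℝ) [μp.Regular] [μm.Regular]
    (hμp : μp univ ≠ 0)
    (hμm : ∀ x : ℝ, μm (Icc x (x + 1)) ≤ ENNReal.ofReal β)
    (l α : ℝ) (hl : 0 < l) (hα : 0 ≤ α)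
    (hμmα : ∀ a b : ℝ, l ≤ b - a → ENNReal.ofReal α ≤ μm (Icc a b))
    (q₀ : ℝ) (hq₀ : q₀ = ⨅ x : ℝ, qstar μp x) :
    ∀ ε : ℝ, 0 < ε → ∃ f g : ℝ → ℂ, MemDom μp f g ∧ 0 < (sqInt volume f).toReal ∧
      formQ μp μm f g <
        (8 / 3 * (Real.pi ^ 2 + 1) * (α * l + 2) * q₀ - α / (2 * l) + ε) *
          (sqInt volume f).toReal := by
  intro ε hε
  set K := 8 / 3 * (Real.pi ^ 2 + 1) * (α * l + 2) with hK
  have hK0 : 0 < K := by positivity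
  obtain ⟨x, d, hd, hμd, hdq⟩ := exists_one_div_sq_lt_of_iInf_lt μp
    (hq₀ ▸ lt_add_of_pos_right q₀ (div_pos hε hK0) : ⨅ x : ℝ, qstar μp x < q₀ + ε / K)
  obtain ⟨h, rfl⟩ : ∃ h, d = 2 * h := ⟨d / 2, by ring⟩
  have hh : 0 < h := by linarith
  rw [mul_div_cancel_left₀ h two_ne_zero] at hμd
  have hnorm : 0 < 2 * h ^ 3 / 3 := by positivity
  refine ⟨_, _, memDom_tent μp (c := x) hh, ?_, ?_⟩
  · rwa [toReal_sqInt_volume_tent hh.le]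
  rw [toReal_sqInt_volume_tent hh.le]
  refine (formQ_tent_le hl hα (fun y => hμmα y (y + l) (by linarith)) hh hμd).trans_lt
    (mul_lt_mul_of_pos_right ?_ hnorm)
  have h1 := mul_lt_mul_of_pos_left hdq hK0
  rw [mul_add, mul_div_cancel₀ ε hK0.ne'] at h1
  rw [← hK]
  linarith
end
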